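/- For every real ℓ > 0, the exponent of the mean ℓ displacement of Hamiltonian paths on SG(n) with one end at o is ℓ·log 2/log 3: lim_{n→∞} ln ξ(n,ℓ) / ln((3^{n+1}+1)/2) = ℓ·(ln 2)/(ln 3). -/

import Mathlib

open scoped Classical
open Filter Topology

noncomputable section

namespace SierpinskiGasket

/-- √3 -/
def sq3 : ℝ := Real.sqrt 3

/-- the origin, leftmost outmost vertex of every `SG n` -/
def o : ℝ × ℝ := (0, 0)

/-- `a m = (2^m, 0)`, the rightmost vertex of `SG m` (also a translation vector). -/
def a (m : ℕ) : ℝ × ℝ := ((2:ℝ) ^ m, 0)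

/-- `b m = (2^(m-1), 2^(m-1)·√3)`, the topmost vertex of `SG m`. -/
def b (m : ℕ) : ℝ × ℝ := ((2:ℝ) ^ m / 2, (2:ℝ) ^ m / 2 * sq3)

/-- `c m = (3·2^(m-1), 2^(m-1)·√3)`. -/
def c (m : ℕ) : ℝ × ℝ := (3 * (2:ℝ) ^ m / 2, (2:ℝ) ^ m / 2 * sq3)

/-- vertex set of `SG n` -/
def V : ℕ → Set (ℝ × ℝ)
  | 0 => {o, a 0, b 0}
  | n + 1 => V n ∪ ((· + a n) '' V n) ∪ ((· + b n) '' V n)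

/-- edge set of `SG n` -/
def E : ℕ → Set (Sym2 (ℝ × ℝ))
  | 0 => {s(o, a 0), s(o, b 0), s(a 0, b 0)}
  | n + 1 => E n ∪ (Sym2.map (· + a n) '' E n) ∪ (Sym2.map (· + b n) '' E n)

/-- `SG n` as a simple graph on `ℝ × ℝ` -/
def G (n : ℕ) : SimpleGraph (ℝ × ℝ) := SimpleGraph.fromEdgeSet (E n)

/-- a Hamiltonian path of `SG n`: a path visiting every vertex of `SG n` exactly once -/
def IsHamPath (n : ℕ) {u v : ℝ × ℝ} (p : (G n).Walk u v) : Prop :=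
  p.IsPath ∧ ∀ x, x ∈ p.support ↔ x ∈ V n

/-- a Hamiltonian cycle of `SG n` -/
def IsHamCycle (n : ℕ) {u : ℝ × ℝ} (p : (G n).Walk u u) : Prop :=
  p.IsCycle ∧ ∀ x, x ∈ p.support ↔ x ∈ V n

/-- `f n u v`: the number of Hamiltonian paths of `SG n` with end-vertex set `{u, v}`
(for `u ≠ v`, such unordered paths correspond bijectively to walks from `u` to `v`). -/
def f (n : ℕ) (u v : ℝ × ℝ) : ℕ := Nat.card {p : (G n).Walk u v // IsHamPath n p}

/-- `f1 n`: the number of Hamiltonian paths of `SG n` with end-vertex set `{o, a n}` -/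
def f1 (n : ℕ) : ℕ := f n o (a n)

/-- the number of Hamiltonian cycles of `SG n`, counted up to starting vertex and
orientation: every Hamiltonian cycle passes through `o` and has exactly two
representatives as a closed walk based at `o`. -/
def HC (n : ℕ) : ℕ := Nat.card {p : (G n).Walk o o // IsHamCycle n p} / 2

/-- the number of Hamiltonian paths of `SG n` having `o` as one of their end vertices -/
def H0 (n : ℕ) : ℕ := ∑ᶠ x ∈ {x : ℝ × ℝ | x ≠ o}, f n o x

/-- the total number of Hamiltonian paths of `SG n` (a path and its reversal
are the same unordered object, whence the division by `2`). -/
def H (n : ℕ) : ℕ := (∑ᶠ u : ℝ × ℝ, ∑ᶠ v : ℝ × ℝ, f n u v) / 2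

/-- the distribution ratio `F(n,x) = f(n,x)/f1(n)` -/
def F (n : ℕ) (x : ℝ × ℝ) : ℝ := (f n o x : ℝ) / (f1 n : ℝ)

/-- `SG n` with the vertex `b n` (and its incident edges) deleted -/
def Gd (n : ℕ) : SimpleGraph (ℝ × ℝ) := SimpleGraph.fromEdgeSet {e ∈ E n | b n ∉ e}

/-- Hamiltonian path of `SG n - b n` -/
def IsHamPathD (n : ℕ) {u v : ℝ × ℝ} (p : (Gd n).Walk u v) : Prop :=
  p.IsPath ∧ ∀ x, x ∈ p.support ↔ (x ∈ V n ∧ x ≠ b n)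

/-- `g2 n x`: the number of Hamiltonian paths of `SG n - b n` with end-vertex set `{o, x}` -/
def g2 (n : ℕ) (x : ℝ × ℝ) : ℕ := Nat.card {p : (Gd n).Walk o x // IsHamPathD n p}

/-- `g1 n`: the number of Hamiltonian paths of `SG n - b n` with end-vertex set `{o, a n}` -/
def g1 (n : ℕ) : ℕ := g2 n (a n)

/-- the distribution ratio `G₂(n,x) = g₂(n,x)/g₁(n)` -/
def G2 (n : ℕ) (x : ℝ × ℝ) : ℝ := (g2 n x : ℝ) / (g1 n : ℝ)

/-- mid-side vertex `a_{m,1} = (3·2^(m-1), 0)` -/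
def a1 (m : ℕ) : ℝ × ℝ := (3 * (2:ℝ) ^ m / 2, 0)

/-- mid-side vertex `b_{m,1} = (5·2^(m-2), 2^(m-2)·√3)` -/
def b1 (m : ℕ) : ℝ × ℝ := (5 * (2:ℝ) ^ m / 4, (2:ℝ) ^ m / 4 * sq3)

/-- mid-side vertex `c_{m,1} = (7·2^(m-2), 2^(m-2)·√3)` -/
def c1 (m : ℕ) : ℝ × ℝ := (7 * (2:ℝ) ^ m / 4, (2:ℝ) ^ m / 4 * sq3)

/-- mid-side vertex `a_{m,2} = (2^m, 2^(m-1)·√3)` -/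
def a2 (m : ℕ) : ℝ × ℝ := ((2:ℝ) ^ m, (2:ℝ) ^ m / 2 * sq3)

/-- mid-side vertex `b_{m,2} = (3·2^(m-2), 3·2^(m-2)·√3)` -/
def b2 (m : ℕ) : ℝ × ℝ := (3 * (2:ℝ) ^ m / 4, 3 * (2:ℝ) ^ m / 4 * sq3)

/-- mid-side vertex `c_{m,2} = (5·2^(m-2), 3·2^(m-2)·√3)` -/
def c2 (m : ℕ) : ℝ × ℝ := (5 * (2:ℝ) ^ m / 4, 3 * (2:ℝ) ^ m / 4 * sq3)

/-- exceptional vertex `a* = (2^(n-1), (2^(n-1)-1)·√3)` -/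
def astar (n : ℕ) : ℝ × ℝ := ((2:ℝ) ^ n / 2, ((2:ℝ) ^ n / 2 - 1) * sq3)

/-- exceptional vertex `b* = (2^(n-1) - 1/2, (2^n-1)·√3/2)` -/
def bstar (n : ℕ) : ℝ × ℝ := ((2:ℝ) ^ n / 2 - 1/2, ((2:ℝ) ^ n - 1) * sq3 / 2)

/-- exceptional vertex `c* = (2^(n-1) + 1/2, (2^n-1)·√3/2)` -/
def cstar (n : ℕ) : ℝ × ℝ := ((2:ℝ) ^ n / 2 + 1/2, ((2:ℝ) ^ n - 1) * sq3 / 2)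

/-- the Euclidean norm on `ℝ × ℝ` -/
def enorm (x : ℝ × ℝ) : ℝ := Real.sqrt (x.1 ^ 2 + x.2 ^ 2)

/-- the set `C n` of corner vertices of `SG n` -/
def C (n : ℕ) : Finset (ℝ × ℝ) :=
  ((Finset.range (n + 1)).image a) ∪ ((Finset.range (n + 1)).image b) ∪
    ((Finset.range n).image c)

/-- the mean `ℓ` displacement over the corner vertices -/
def xi' (n : ℕ) (ℓ : ℝ) : ℝ :=
  (∑ x ∈ C n, enorm x ^ ℓ * F n x) / (∑ x ∈ C n, F n x)

/-- `p(n,x)`: the probability that a Hamiltonian path with one end at `o`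
has its other end at `x` -/
def p (n : ℕ) (x : ℝ × ℝ) : ℝ := (f n o x : ℝ) / (H0 n : ℝ)

/-- the mean `ℓ` displacement of Hamiltonian paths on `SG n` with one end at `o` -/
def xi (n : ℕ) (ℓ : ℝ) : ℝ :=
  ∑ᶠ x ∈ {x : ℝ × ℝ | x ∈ V n ∧ x ≠ o}, enorm x ^ ℓ * p n x

/-- the partition function of Hamiltonian paths on `SG n` -/
def Z (n : ℕ) (β : ℝ) : ℝ := (H n : ℝ) * Real.exp (-(β * ((3 ^ (n + 1) + 1) / 2)))


/-! ### Reflections and recursive structure of the vertex and edge sets -/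

lemma sq3_sq : sq3 * sq3 = 3 := Real.mul_self_sqrt (by norm_num)

lemma sq3_pos : 0 < sq3 := Real.sqrt_pos.2 (by norm_num)

/-- the reflection exchanging the corners `o` and `a n` of `SG n` -/
def reflOA (n : ℕ) (x : ℝ × ℝ) : ℝ × ℝ := ((2:ℝ) ^ n - x.1, x.2)

/-- the reflection exchanging the corners `a n` and `b n` of every `SG n` -/
def reflAB (x : ℝ × ℝ) : ℝ × ℝ := (x.1 / 2 + sq3 / 2 * x.2, sq3 / 2 * x.1 - x.2 / 2)

lemma reflOA_reflOA (n : ℕ) (x : ℝ × ℝ) : reflOA n (reflOA n x) = x := by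
  simp [reflOA]

lemma reflAB_reflAB (x : ℝ × ℝ) : reflAB (reflAB x) = x := by
  have h := sq3_sq
  ext <;> simp only [reflAB]
  · linear_combination x.1 / 4 * h
  · linear_combination x.2 / 4 * h

lemma reflOA_injective (n : ℕ) : Function.Injective (reflOA n) :=
  (Function.LeftInverse.injective (reflOA_reflOA n))

lemma reflAB_injective : Function.Injective reflAB :=
  (Function.LeftInverse.injective reflAB_reflAB)

lemma reflAB_add (x y : ℝ × ℝ) : reflAB (x + y) = reflAB x + reflAB y := by
  ext <;> simp only [reflAB, Prod.fst_add, Prod.snd_add] <;> ring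

@[simp] lemma reflAB_o : reflAB o = o := by simp [reflAB, o]

@[simp] lemma reflAB_a (n : ℕ) : reflAB (a n) = b n := by
  ext <;> simp only [reflAB, a, b] <;> ring

@[simp] lemma reflAB_b (n : ℕ) : reflAB (b n) = a n := by
  rw [← reflAB_a, reflAB_reflAB]

@[simp] lemma reflOA_o (n : ℕ) : reflOA n o = a n := by simp [reflOA, o, a]

@[simp] lemma reflOA_a (n : ℕ) : reflOA n (a n) = o := by simp [reflOA, o, a]

@[simp] lemma reflOA_b (n : ℕ) : reflOA n (b n) = b n := by
  ext
  · simp only [reflOA, b]; ring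
  · rfl

lemma reflOA_succ (n : ℕ) (x : ℝ × ℝ) : reflOA (n + 1) x = reflOA n x + a n := by
  ext <;> simp only [reflOA, a, Prod.fst_add, Prod.snd_add] <;> ring

lemma reflOA_succ_add_a (n : ℕ) (x : ℝ × ℝ) : reflOA (n + 1) (x + a n) = reflOA n x := by
  ext
  · simp only [reflOA, a, Prod.fst_add]; ring
  · simp [reflOA, a]

lemma reflOA_succ_add_b (n : ℕ) (x : ℝ × ℝ) :
    reflOA (n + 1) (x + b n) = reflOA n x + b n := by
  ext
  · simp only [reflOA, b, Prod.fst_add]; ring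
  · rfl

lemma a_add_a (n : ℕ) : a n + a n = a (n + 1) := by
  ext <;> simp only [a, Prod.fst_add, Prod.snd_add] <;> ring

lemma b_add_b (n : ℕ) : b n + b n = b (n + 1) := by
  ext <;> simp only [b, Prod.fst_add, Prod.snd_add] <;> ring

lemma mem_V_succ {n : ℕ} {x : ℝ × ℝ} :
    x ∈ V (n + 1) ↔ x ∈ V n ∨ (∃ y ∈ V n, y + a n = x) ∨ ∃ y ∈ V n, y + b n = x := by
  simp only [V, Set.mem_union, Set.mem_image, or_assoc]

lemma mk_mem_map_image {S : Set (Sym2 (ℝ × ℝ))} {d x y : ℝ × ℝ} :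
    s(x, y) ∈ Sym2.map (· + d) '' S ↔ ∃ u v, s(u, v) ∈ S ∧ u + d = x ∧ v + d = y := by
  constructor
  · rintro ⟨e, he, h⟩
    induction e using Sym2.ind with
    | _ u v =>
      rw [Sym2.map_mk, Sym2.eq_iff] at h
      rcases h with ⟨h1, h2⟩ | ⟨h1, h2⟩
      · exact ⟨u, v, he, h1, h2⟩
      · exact ⟨v, u, Sym2.eq_swap ▸ he, h2, h1⟩
  · rintro ⟨u, v, h, rfl, rfl⟩
    exact ⟨s(u, v), h, rfl⟩

lemma mem_E_succ {n : ℕ} {x y : ℝ × ℝ} :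
    s(x, y) ∈ E (n + 1) ↔ s(x, y) ∈ E n ∨
      (∃ u v, s(u, v) ∈ E n ∧ u + a n = x ∧ v + a n = y) ∨
      ∃ u v, s(u, v) ∈ E n ∧ u + b n = x ∧ v + b n = y := by
  simp only [E, Set.mem_union, mk_mem_map_image, or_assoc]

lemma V_finite (n : ℕ) : (V n).Finite := by
  induction n with
  | zero => simp [V]
  | succ n ih => exact (ih.union (ih.image _)).union (ih.image _)

lemma o_mem_V (n : ℕ) : o ∈ V n := by
  induction n with
  | zero => simp [V]
  | succ n ih => exact mem_V_succ.2 (.inl ih)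

lemma a_mem_V (n : ℕ) : a n ∈ V n := by
  induction n with
  | zero => simp [V]
  | succ n ih => exact mem_V_succ.2 (.inr (.inl ⟨_, ih, a_add_a n⟩))

lemma reflAB_mem_V {n : ℕ} {x : ℝ × ℝ} (hx : x ∈ V n) : reflAB x ∈ V n := by
  induction n generalizing x with
  | zero =>
    rcases hx with rfl | rfl | rfl <;> simp [V]
  | succ n ih =>
    rcases mem_V_succ.1 hx with h | ⟨y, h, rfl⟩ | ⟨y, h, rfl⟩
    · exact mem_V_succ.2 (.inl (ih h))
    · exact mem_V_succ.2 (.inr (.inr ⟨_, ih h, by simp [reflAB_add]⟩))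
    · exact mem_V_succ.2 (.inr (.inl ⟨_, ih h, by simp [reflAB_add]⟩))

lemma reflOA_mem_V {n : ℕ} {x : ℝ × ℝ} (hx : x ∈ V n) : reflOA n x ∈ V n := by
  induction n generalizing x with
  | zero =>
    rcases hx with rfl | rfl | rfl <;> simp [V]
  | succ n ih =>
    rcases mem_V_succ.1 hx with h | ⟨y, h, rfl⟩ | ⟨y, h, rfl⟩
    · exact mem_V_succ.2 (.inr (.inl ⟨_, ih h, (reflOA_succ n x).symm⟩))
    · exact mem_V_succ.2 (.inl (by rw [reflOA_succ_add_a]; exact ih h))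
    · exact mem_V_succ.2 (.inr (.inr ⟨_, ih h, (reflOA_succ_add_b n y).symm⟩))

lemma b_mem_V (n : ℕ) : b n ∈ V n := reflAB_a n ▸ reflAB_mem_V (a_mem_V n)

lemma reflOA_mem_V_iff {n : ℕ} {x : ℝ × ℝ} : reflOA n x ∈ V n ↔ x ∈ V n :=
  ⟨fun h => reflOA_reflOA n x ▸ reflOA_mem_V h, reflOA_mem_V⟩

lemma reflAB_mem_E {n : ℕ} {x y : ℝ × ℝ} (he : s(x, y) ∈ E n) :
    s(reflAB x, reflAB y) ∈ E n := by
  induction n generalizing x y with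
  | zero =>
    simp only [E, Set.mem_insert_iff, Set.mem_singleton_iff, Sym2.eq_iff] at he ⊢
    rcases he with (⟨rfl, rfl⟩ | ⟨rfl, rfl⟩) | (⟨rfl, rfl⟩ | ⟨rfl, rfl⟩) |
      (⟨rfl, rfl⟩ | ⟨rfl, rfl⟩) <;> simp
  | succ n ih =>
    rcases mem_E_succ.1 he with h | ⟨u, v, h, rfl, rfl⟩ | ⟨u, v, h, rfl, rfl⟩
    · exact mem_E_succ.2 (.inl (ih h))
    · exact mem_E_succ.2 (.inr (.inr ⟨_, _, ih h, by simp [reflAB_add], by simp [reflAB_add]⟩))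
    · exact mem_E_succ.2 (.inr (.inl ⟨_, _, ih h, by simp [reflAB_add], by simp [reflAB_add]⟩))

lemma reflOA_mem_E {n : ℕ} {x y : ℝ × ℝ} (he : s(x, y) ∈ E n) :
    s(reflOA n x, reflOA n y) ∈ E n := by
  induction n generalizing x y with
  | zero =>
    simp only [E, Set.mem_insert_iff, Set.mem_singleton_iff, Sym2.eq_iff] at he ⊢
    rcases he with (⟨rfl, rfl⟩ | ⟨rfl, rfl⟩) | (⟨rfl, rfl⟩ | ⟨rfl, rfl⟩) |
      (⟨rfl, rfl⟩ | ⟨rfl, rfl⟩) <;> simp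
  | succ n ih =>
    rcases mem_E_succ.1 he with h | ⟨u, v, h, rfl, rfl⟩ | ⟨u, v, h, rfl, rfl⟩
    · exact mem_E_succ.2 (.inr (.inl ⟨_, _, ih h, (reflOA_succ _ _).symm, (reflOA_succ _ _).symm⟩))
    · exact mem_E_succ.2 (.inl (by simpa only [reflOA_succ_add_a] using ih h))
    · exact mem_E_succ.2 (.inr (.inr ⟨_, _, ih h, (reflOA_succ_add_b _ _).symm,
        (reflOA_succ_add_b _ _).symm⟩))

lemma mem_V_of_mem_E {n : ℕ} {x y : ℝ × ℝ} (he : s(x, y) ∈ E n) : x ∈ V n ∧ y ∈ V n := by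
  induction n generalizing x y with
  | zero =>
    simp only [E, Set.mem_insert_iff, Set.mem_singleton_iff, Sym2.eq_iff] at he
    rcases he with (⟨rfl, rfl⟩ | ⟨rfl, rfl⟩) | (⟨rfl, rfl⟩ | ⟨rfl, rfl⟩) |
      (⟨rfl, rfl⟩ | ⟨rfl, rfl⟩) <;> simp [V]
  | succ n ih =>
    rcases mem_E_succ.1 he with h | ⟨u, v, h, rfl, rfl⟩ | ⟨u, v, h, rfl, rfl⟩
    · exact ⟨mem_V_succ.2 (.inl (ih h).1), mem_V_succ.2 (.inl (ih h).2)⟩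
    · exact ⟨mem_V_succ.2 (.inr (.inl ⟨_, (ih h).1, rfl⟩)),
        mem_V_succ.2 (.inr (.inl ⟨_, (ih h).2, rfl⟩))⟩
    · exact ⟨mem_V_succ.2 (.inr (.inr ⟨_, (ih h).1, rfl⟩)),
        mem_V_succ.2 (.inr (.inr ⟨_, (ih h).2, rfl⟩))⟩

/-- `SG n` lies in the equilateral triangle with corners `o`, `a n`, `b n`. -/
lemma mem_triangle {n : ℕ} {x : ℝ × ℝ} (hx : x ∈ V n) :
    0 ≤ x.2 ∧ x.2 ≤ sq3 * x.1 ∧ sq3 * x.1 + x.2 ≤ sq3 * 2 ^ n := by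
  have hs := sq3_pos
  induction n generalizing x with
  | zero =>
    rcases hx with rfl | rfl | rfl <;> simp only [o, a, b] <;>
      refine ⟨?_, ?_, ?_⟩ <;> nlinarith
  | succ n ih =>
    have h2 : 0 < sq3 * 2 ^ n := by positivity
    rcases mem_V_succ.1 hx with h | ⟨y, h, rfl⟩ | ⟨y, h, rfl⟩ <;>
      obtain ⟨h0, h1, h3⟩ := ih h <;>
      simp only [a, b, Prod.fst_add, Prod.snd_add, pow_succ, mul_add] <;>
      refine ⟨?_, ?_, ?_⟩ <;> nlinarith

lemma fst_nonneg {n : ℕ} {x : ℝ × ℝ} (hx : x ∈ V n) : 0 ≤ x.1 := by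
  obtain ⟨h0, h1, -⟩ := mem_triangle hx
  exact nonneg_of_mul_nonneg_right (h0.trans h1) sq3_pos

lemma eq_a_of_add_a_mem {n : ℕ} {y : ℝ × ℝ} (hy : y ∈ V n) (h : y + a n ∈ V n) : y = o := by
  have hs := sq3_pos
  obtain ⟨h0, h1, -⟩ := mem_triangle hy
  obtain ⟨-, -, h2⟩ := mem_triangle h
  simp only [a, Prod.fst_add, Prod.snd_add, mul_add] at h2
  ext
  · exact (mul_eq_zero.1 (by linarith : sq3 * y.1 = 0)).resolve_left hs.ne'
  · simp only [o]; linarith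

lemma eq_b_of_add_b_mem {n : ℕ} {y : ℝ × ℝ} (hy : y ∈ V n) (h : y + b n ∈ V n) : y = o := by
  have h' := reflAB_mem_V h
  rw [reflAB_add, reflAB_b] at h'
  have := eq_a_of_add_a_mem (reflAB_mem_V hy) h'
  rw [← reflAB_reflAB y, this, reflAB_o]

/-- the lower right and the upper copy of `SG n` in `SG (n + 1)` meet only in one corner -/
lemma eq_of_add_a_eq_add_b {n : ℕ} {y z : ℝ × ℝ} (hy : y ∈ V n) (hz : z ∈ V n)
    (h : y + a n = z + b n) : y = b n ∧ z = a n := by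
  have hs := sq3_pos
  obtain ⟨h0, h1, h2⟩ := mem_triangle hy
  obtain ⟨h3, h4, h5⟩ := mem_triangle hz
  have e1 := congrArg Prod.fst h
  have e2 := congrArg Prod.snd h
  simp only [a, b, Prod.fst_add, Prod.snd_add] at e1 e2
  have e3 : sq3 * y.1 + sq3 * 2 ^ n = sq3 * z.1 + sq3 * 2 ^ n / 2 := by
    linear_combination sq3 * e1
  have hz2 : z.2 = 0 := by nlinarith
  have hz1 : z.1 = 2 ^ n := mul_left_cancel₀ hs.ne' (by nlinarith)
  refine ⟨?_, ?_⟩ <;> ext <;> simp only [a, b] <;> nlinarith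

lemma o_ne_a (n : ℕ) : o ≠ a n := fun h => by
  have := congrArg Prod.fst h
  simp only [o, a] at this
  exact absurd this.symm (by positivity)

lemma o_ne_b (n : ℕ) : o ≠ b n := fun h =>
  o_ne_a n (by rw [← reflAB_o, h, reflAB_b])

lemma a_ne_b (n : ℕ) : a n ≠ b n := fun h => by
  have := congrArg Prod.fst h
  simp only [a, b] at this
  have h2 : (0:ℝ) < 2 ^ n := by positivity
  linarith

lemma adj_iff {n : ℕ} {x y : ℝ × ℝ} : (G n).Adj x y ↔ s(x, y) ∈ E n ∧ x ≠ y :=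
  SimpleGraph.fromEdgeSet_adj _

/-- edges of `SG (n + 1)` leaving `SG n` start at `a n` or `b n` -/
lemma eq_a_or_eq_b_of_adj {n : ℕ} {x y : ℝ × ℝ} (hxy : (G (n + 1)).Adj x y) (hx : x ∈ V n)
    (hy : y ∉ V n) : x = a n ∨ x = b n := by
  rcases mem_E_succ.1 (adj_iff.1 hxy).1 with h | ⟨u, v, h, rfl, rfl⟩ | ⟨u, v, h, rfl, rfl⟩
  · exact absurd (mem_V_of_mem_E h).2 hy
  · left; rw [eq_a_of_add_a_mem (mem_V_of_mem_E h).1 hx]; simp [o]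
  · right; rw [eq_b_of_add_b_mem (mem_V_of_mem_E h).1 hx]; simp [o]

lemma adj_of_adj_succ {n : ℕ} {x y : ℝ × ℝ} (hxy : (G (n + 1)).Adj x y) (hx : x ∈ V n)
    (hy : y ∈ V n) : (G n).Adj x y := by
  refine adj_iff.2 ⟨?_, hxy.ne⟩
  have hne := hxy.ne
  rcases mem_E_succ.1 (adj_iff.1 hxy).1 with h | ⟨u, v, h, rfl, rfl⟩ | ⟨u, v, h, rfl, rfl⟩
  · exact h
  · rw [eq_a_of_add_a_mem (mem_V_of_mem_E h).1 hx, eq_a_of_add_a_mem (mem_V_of_mem_E h).2 hy] at hne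
    exact absurd rfl hne
  · rw [eq_b_of_add_b_mem (mem_V_of_mem_E h).1 hx, eq_b_of_add_b_mem (mem_V_of_mem_E h).2 hy] at hne
    exact absurd rfl hne

lemma adj_succ {n : ℕ} {x y : ℝ × ℝ} (h : (G n).Adj x y) : (G (n + 1)).Adj x y :=
  adj_iff.2 ⟨mem_E_succ.2 (.inl (adj_iff.1 h).1), h.ne⟩

lemma adj_succ_add_a {n : ℕ} {x y : ℝ × ℝ} (h : (G n).Adj x y) :
    (G (n + 1)).Adj (x + a n) (y + a n) :=
  adj_iff.2 ⟨mem_E_succ.2 (.inr (.inl ⟨_, _, (adj_iff.1 h).1, rfl, rfl⟩)), by simpa using h.ne⟩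

lemma adj_succ_add_b {n : ℕ} {x y : ℝ × ℝ} (h : (G n).Adj x y) :
    (G (n + 1)).Adj (x + b n) (y + b n) :=
  adj_iff.2 ⟨mem_E_succ.2 (.inr (.inr ⟨_, _, (adj_iff.1 h).1, rfl, rfl⟩)), by simpa using h.ne⟩

lemma adj_reflAB {n : ℕ} {x y : ℝ × ℝ} (h : (G n).Adj x y) : (G n).Adj (reflAB x) (reflAB y) :=
  adj_iff.2 ⟨reflAB_mem_E (adj_iff.1 h).1, reflAB_injective.ne h.ne⟩

lemma adj_reflOA {n : ℕ} {x y : ℝ × ℝ} (h : (G n).Adj x y) :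
    (G n).Adj (reflOA n x) (reflOA n y) :=
  adj_iff.2 ⟨reflOA_mem_E (adj_iff.1 h).1, (reflOA_injective n).ne h.ne⟩

/-! ### Hamiltonian paths as lists of vertices -/

/-- `l` lists the vertices of a path of `SG n` from `u` to `v` visiting exactly the set `S`. -/
structure IsHamList (n : ℕ) (S : Set (ℝ × ℝ)) (u v : ℝ × ℝ) (l : List (ℝ × ℝ)) : Prop where
  chain : l.IsChain (G n).Adj
  nodup : l.Nodup
  mem_iff : ∀ x, x ∈ l ↔ x ∈ S
  head : l.head? = some u
  last : l.getLast? = some v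

lemma IsHamList.map {n m : ℕ} {S : Set (ℝ × ℝ)} {u v : ℝ × ℝ} {l : List (ℝ × ℝ)}
    (h : IsHamList n S u v l) {φ : ℝ × ℝ → ℝ × ℝ} (hφ : Function.Injective φ)
    (hadj : ∀ x y, (G n).Adj x y → (G m).Adj (φ x) (φ y)) :
    IsHamList m (φ '' S) (φ u) (φ v) (l.map φ) where
  chain := List.isChain_map_of_isChain φ hadj h.chain
  nodup := h.nodup.map hφ
  mem_iff x := by simp [h.mem_iff]
  head := by simp [h.head]
  last := by simp [h.last]

lemma IsHamList.reverse {n : ℕ} {S : Set (ℝ × ℝ)} {u v : ℝ × ℝ} {l : List (ℝ × ℝ)}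
    (h : IsHamList n S u v l) : IsHamList n S v u l.reverse where
  chain := List.isChain_reverse.2 (h.chain.imp fun _ _ e => e.symm)
  nodup := List.nodup_reverse.2 h.nodup
  mem_iff x := by simp [h.mem_iff]
  head := by simp [h.last]
  last := by simp [h.head]

lemma IsHamList.exists_trans {n : ℕ} {S T : Set (ℝ × ℝ)} {u v w : ℝ × ℝ} {l l' : List (ℝ × ℝ)}
    (h : IsHamList n S u v l) (h' : IsHamList n T v w l') (hST : ∀ x ∈ S, x ∈ T → x = v) :
    ∃ k, IsHamList n (S ∪ T) u w k := by
  obtain ⟨l, rfl⟩ := List.getLast?_eq_some_iff.1 h.last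
  obtain ⟨l', rfl⟩ := List.head?_eq_some_iff.1 h'.head
  have hd := h'.nodup
  rw [List.nodup_cons] at hd
  refine ⟨l ++ v :: l', List.isChain_split.2 ⟨h.chain, h'.chain⟩, ?_, fun x => ?_, ?_, ?_⟩
  · rw [← List.singleton_append, ← List.append_assoc, List.nodup_append']
    refine ⟨h.nodup, hd.2, fun x hx hx' => hd.1 ?_⟩
    rwa [← hST x ((h.mem_iff x).1 hx) ((h'.mem_iff x).1 (List.mem_cons_of_mem _ hx'))]
  · rw [Set.mem_union, ← h.mem_iff, ← h'.mem_iff]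
    simp only [List.mem_append, List.mem_cons, List.not_mem_nil, or_false]
    tauto
  · have := h.head
    cases l <;> simpa using this
  · have := h'.last
    simpa using this

lemma isHamList_finite (n : ℕ) (u v : ℝ × ℝ) : {l | IsHamList n (V n) u v l}.Finite := by
  refine ((V_finite n).toFinset.toList.permutations.toFinset.finite_toSet).subset fun l hl => ?_
  rw [Finset.mem_coe, List.mem_toFinset, List.mem_permutations,
    List.perm_ext_iff_of_nodup hl.nodup (Finset.nodup_toList _)]
  simp [hl.mem_iff]

lemma f_eq_ncard (n : ℕ) (u v : ℝ × ℝ) : f n u v = {l | IsHamList n (V n) u v l}.ncard := by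
  refine Nat.card_congr (Equiv.ofBijective (fun p => ⟨p.1.support, p.1.isChain_adj_support,
    p.2.1.support_nodup, p.2.2, ?_, ?_⟩) ⟨fun p q h => ?_, fun ⟨l, hl⟩ => ?_⟩)
  · simp [List.head?_eq_some_head p.1.support_ne_nil]
  · simp [List.getLast?_eq_some_getLast p.1.support_ne_nil]
  · exact Subtype.ext (SimpleGraph.Walk.ext_support (Subtype.mk.inj h))
  · have hne : l ≠ [] := by rintro rfl; simpa using hl.head
    obtain rfl : l.head hne = u := by
      simpa [List.head?_eq_some_head hne] using hl.head
    obtain rfl : l.getLast hne = v := by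
      simpa [List.getLast?_eq_some_getLast hne] using hl.last
    refine ⟨⟨SimpleGraph.Walk.ofSupport l hne hl.chain, ?_, ?_⟩, ?_⟩
    · rw [SimpleGraph.Walk.isPath_def, SimpleGraph.Walk.support_ofSupport]
      exact hl.nodup
    · rw [SimpleGraph.Walk.support_ofSupport]
      exact hl.mem_iff
    · exact Subtype.ext (SimpleGraph.Walk.support_ofSupport hne hl.chain)

lemma mem_V_of_f_ne_zero {n : ℕ} {x : ℝ × ℝ} (h : f n o x ≠ 0) : x ∈ V n := by
  rw [f_eq_ncard] at h
  obtain ⟨l, hl⟩ := Set.nonempty_of_ncard_ne_zero h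
  exact (hl.mem_iff x).1 (List.mem_of_getLast? hl.last)

/-! ### Existence of Hamiltonian paths between two corners -/

lemma image_reflAB (n : ℕ) : reflAB '' V n = V n :=
  Set.ext fun x => ⟨by rintro ⟨y, hy, rfl⟩; exact reflAB_mem_V hy,
    fun h => ⟨_, reflAB_mem_V h, reflAB_reflAB x⟩⟩

lemma image_reflOA (n : ℕ) : reflOA n '' V n = V n :=
  Set.ext fun x => ⟨by rintro ⟨y, hy, rfl⟩; exact reflOA_mem_V hy,
    fun h => ⟨_, reflOA_mem_V h, reflOA_reflOA n x⟩⟩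

lemma exists_isHamList (n : ℕ) :
    (∃ l, IsHamList n (V n) o (a n) l) ∧ ∃ l, IsHamList n (V n \ {b n}) o (a n) l := by
  induction n with
  | zero =>
    have h1 := o_ne_a 0
    have h2 := o_ne_b 0
    have h3 := a_ne_b 0
    refine ⟨⟨[o, b 0, a 0], ?_, ?_, ?_, rfl, rfl⟩, ⟨[o, a 0], ?_, ?_, ?_, rfl, rfl⟩⟩
    · simp [adj_iff, E, h2, h3.symm]
    · simp [h1, h2, h3.symm]
    · intro x; simp [V]; tauto
    · simp [adj_iff, E, h1]
    · simp [h1]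
    · intro x
      simp only [V, List.mem_cons, List.not_mem_nil, or_false, Set.mem_sdiff, Set.mem_insert_iff,
        Set.mem_singleton_iff]
      constructor
      · rintro (rfl | rfl) <;> simp [h2, h3]
      · tauto
  | succ n ih =>
    obtain ⟨⟨l, hl⟩, ⟨k, hk⟩⟩ := ih
    have h1 := hl.map reflAB_injective fun _ _ => adj_reflAB
    have h1 := h1.map Function.injective_id fun _ _ => adj_succ
    have h2 := hl.map (add_left_injective (b n)) fun _ _ => adj_succ_add_b
    have h2' := hk.map (add_left_injective (b n)) fun _ _ => adj_succ_add_b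
    have h3 := (hk.map reflAB_injective fun _ _ => adj_reflAB).map (reflOA_injective n)
      fun _ _ => adj_reflOA
    have h3 := h3.reverse.map (add_left_injective (a n)) fun _ _ => adj_succ_add_a
    simp only [Set.image_sdiff reflAB_injective, Set.image_sdiff (reflOA_injective n), image_reflAB,
      image_reflOA, Set.image_singleton, reflAB_a, reflAB_b, reflAB_o, reflOA_a, reflOA_o,
      reflOA_b, id, Set.image_id', a_add_a] at h1 h3
    have ho (x : ℝ × ℝ) : o + x = x := by simp [o]
    rw [ho] at h2 h2'
    rw [add_comm (b n)] at h3
    have h4 {y : ℝ × ℝ} (hy : y ∈ V n) (hyo : y ≠ o) : y + a n ∉ V n :=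
      fun h => hyo (eq_a_of_add_a_mem hy h)
    constructor
    · obtain ⟨r, hr⟩ := h1.exists_trans h2 (by
        rintro x hx ⟨y, hy, rfl⟩
        simp only at hx ⊢
        rw [eq_b_of_add_b_mem hy hx, ho])
      obtain ⟨r, hr⟩ := hr.exists_trans h3 (by
        rintro x hx ⟨y, ⟨hy, hyo⟩, rfl⟩
        rcases hx with hx | ⟨z, hz, hzy⟩
        · exact absurd hx (h4 hy hyo)
        · simp only at hzy ⊢
          rw [(eq_of_add_a_eq_add_b hy hz hzy.symm).1, add_comm])
      refine ⟨r, ?_⟩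
      convert hr using 1
      ext x
      rw [mem_V_succ]
      constructor
      · rintro (h | ⟨y, hy, rfl⟩ | h)
        · exact .inl (.inl h)
        · by_cases hyo : y = o
          · rw [hyo, ho]; exact .inl (.inl (a_mem_V n))
          · exact .inr ⟨y, ⟨hy, hyo⟩, rfl⟩
        · exact .inl (.inr h)
      · rintro ((h | h) | ⟨y, ⟨hy, -⟩, rfl⟩)
        · exact .inl h
        · exact .inr (.inr h)
        · exact .inr (.inl ⟨y, hy, rfl⟩)
    · obtain ⟨r, hr⟩ := h1.exists_trans h2' (by
        rintro x hx ⟨y, hy, rfl⟩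
        simp only at hx ⊢
        rw [eq_b_of_add_b_mem hy.1 hx, ho])
      obtain ⟨r, hr⟩ := hr.exists_trans h3 (by
        rintro x hx ⟨y, ⟨hy, hyo⟩, rfl⟩
        rcases hx with hx | ⟨z, hz, hzy⟩
        · exact absurd hx (h4 hy hyo)
        · simp only at hzy ⊢
          rw [(eq_of_add_a_eq_add_b hy hz.1 hzy.symm).1, add_comm])
      refine ⟨r, ?_⟩
      convert hr using 1
      ext x
      rw [Set.mem_sdiff, mem_V_succ, Set.mem_singleton_iff, ← b_add_b]
      constructor
      · rintro ⟨h | ⟨y, hy, rfl⟩ | ⟨y, hy, rfl⟩, hx⟩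
        · exact .inl (.inl h)
        · by_cases hyo : y = o
          · rw [hyo, ho]; exact .inl (.inl (a_mem_V n))
          · exact .inr ⟨y, ⟨hy, hyo⟩, rfl⟩
        · exact .inl (.inr ⟨y, ⟨hy, fun h => hx (by rw [Set.mem_singleton_iff.1 h])⟩, rfl⟩)
      · rintro ((h | ⟨y, ⟨hy, hyb⟩, rfl⟩) | ⟨y, ⟨hy, -⟩, rfl⟩)
        · refine ⟨.inl h, ?_⟩
          rintro rfl
          exact o_ne_b n (eq_b_of_add_b_mem (b_mem_V n) h).symm
        · exact ⟨.inr (.inr ⟨y, hy, rfl⟩), fun h => hyb (add_right_cancel h)⟩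
        · exact ⟨.inr (.inl ⟨y, hy, rfl⟩), fun h =>
            a_ne_b n (eq_of_add_a_eq_add_b hy (b_mem_V n) h).2.symm⟩

lemma f_o_a_pos (n : ℕ) : 0 < f n o (a n) := by
  rw [f_eq_ncard, Set.ncard_pos (isHamList_finite _ _ _)]
  exact (exists_isHamList n).1

/-! ### Reflecting the part of a Hamiltonian path inside the copy of `SG n` containing `o` -/

/-- `reflOA n` on the vertices of `SG n`, the identity elsewhere -/
def partRefl (n : ℕ) (x : ℝ × ℝ) : ℝ × ℝ := if x ∈ V n then reflOA n x else x

lemma partRefl_of_mem {n : ℕ} {x : ℝ × ℝ} (h : x ∈ V n) : partRefl n x = reflOA n x := if_pos h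

lemma partRefl_of_notMem {n : ℕ} {x : ℝ × ℝ} (h : x ∉ V n) : partRefl n x = x := if_neg h

lemma partRefl_mem_V_iff {n : ℕ} {x : ℝ × ℝ} : partRefl n x ∈ V n ↔ x ∈ V n := by
  by_cases h : x ∈ V n
  · rw [partRefl_of_mem h, reflOA_mem_V_iff]
  · rw [partRefl_of_notMem h]

lemma partRefl_partRefl (n : ℕ) (x : ℝ × ℝ) : partRefl n (partRefl n x) = x := by
  by_cases h : x ∈ V n
  · rw [partRefl_of_mem (partRefl_mem_V_iff.2 h), partRefl_of_mem h, reflOA_reflOA]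
  · rw [partRefl_of_notMem (mt partRefl_mem_V_iff.1 h), partRefl_of_notMem h]

lemma partRefl_injective (n : ℕ) : Function.Injective (partRefl n) :=
  Function.LeftInverse.injective (partRefl_partRefl n)

lemma partRefl_mem_V_succ_iff {n : ℕ} {x : ℝ × ℝ} :
    partRefl n x ∈ V (n + 1) ↔ x ∈ V (n + 1) := by
  by_cases h : x ∈ V n
  · exact iff_of_true (mem_V_succ.2 (.inl (partRefl_mem_V_iff.2 h))) (mem_V_succ.2 (.inl h))
  · rw [partRefl_of_notMem h]

@[simp] lemma partRefl_o (n : ℕ) : partRefl n o = a n := by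
  rw [partRefl_of_mem (o_mem_V n), reflOA_o]

@[simp] lemma partRefl_a (n : ℕ) : partRefl n (a n) = o := by
  rw [partRefl_of_mem (a_mem_V n), reflOA_a]

@[simp] lemma partRefl_b (n : ℕ) : partRefl n (b n) = b n := by
  rw [partRefl_of_mem (b_mem_V n), reflOA_b]

lemma isChain_map_partRefl {n : ℕ} {l : List (ℝ × ℝ)} (h : l.IsChain (G (n + 1)).Adj)
    (hl : ∀ y ∈ l, y ∈ V n) : (l.map (partRefl n)).IsChain (G (n + 1)).Adj := by
  rw [List.isChain_map]
  refine h.imp_of_mem_imp fun x y hx hy hxy => ?_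
  rw [partRefl_of_mem (hl x hx), partRefl_of_mem (hl y hy)]
  exact adj_succ (adj_reflOA (adj_of_adj_succ hxy (hl x hx) (hl y hy)))

lemma forall_mem_V_or_forall_notMem_V {n : ℕ} {l : List (ℝ × ℝ)}
    (h : l.IsChain (G (n + 1)).Adj) (ha : a n ∉ l) (hb : b n ∉ l) :
    (∀ y ∈ l, y ∈ V n) ∨ ∀ y ∈ l, y ∉ V n := by
  induction l with
  | nil => simp
  | cons x l ih =>
    rw [List.mem_cons, not_or] at ha hb
    cases l with
    | nil => by_cases hx : x ∈ V n <;> simp [hx]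
    | cons y l =>
      rw [List.isChain_cons_cons] at h
      have hya : y ≠ a n := fun e => ha.2 (by simp [e])
      have hyb : y ≠ b n := fun e => hb.2 (by simp [e])
      rcases ih h.2 ha.2 hb.2 with H | H
      · refine .inl (List.forall_mem_cons.2 ⟨?_, H⟩)
        by_contra hx
        rcases eq_a_or_eq_b_of_adj h.1.symm (H y (by simp)) hx with e | e
        exacts [hya e, hyb e]
      · refine .inr (List.forall_mem_cons.2 ⟨fun hx => ?_, H⟩)
        rcases eq_a_or_eq_b_of_adj h.1 hx (H y (by simp)) with e | e
        exacts [ha.1 e.symm, hb.1 e.symm]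

lemma getLast?_cons_append_cons {α : Type*} (x y : α) (l k : List α) :
    (x :: (l ++ y :: k)).getLast? = (y :: k).getLast? := by
  rw [← List.cons_append, List.getLast?_append_cons]

/-- Hamiltonian paths `o, P, a n, R` of `SG (n + 1)` ending at `x` that, after a first piece `P`
inside `SG n`, leave `SG n` at `a n` and come back at `b n` to end in `SG n`. -/
def returning (n : ℕ) (x : ℝ × ℝ) : Set (List (ℝ × ℝ) × List (ℝ × ℝ)) :=
  {q | IsHamList (n + 1) (V (n + 1)) o x (o :: (q.1 ++ a n :: q.2)) ∧ (∀ y ∈ q.1, y ∈ V n) ∧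
    ∃ M Q, q.2 = M ++ b n :: Q ∧ (∀ y ∈ M, y ∉ V n) ∧ ∀ y ∈ Q, y ∈ V n}

lemma IsHamList.mem_returning {n : ℕ} {x : ℝ × ℝ} {l A B : List (ℝ × ℝ)}
    (h : IsHamList (n + 1) (V (n + 1)) o x l) (hl : l = A ++ a n :: B) (hbB : b n ∈ B)
    (hx : x ∈ V n) (hxb : x ≠ b n) :
    ∃ q ∈ returning n x, o :: (q.1 ++ a n :: q.2) = l := by
  subst hl
  obtain ⟨M, Q, rfl⟩ := List.append_of_mem hbB
  have hd := h.nodup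
  have hA : ∃ P, A = o :: P := by
    have := h.head
    cases A with
    | nil => exact absurd (by simpa using this.symm) (o_ne_a n)
    | cons y P => exact ⟨P, by simpa using this⟩
  obtain ⟨P, rfl⟩ := hA
  have hP := forall_mem_V_or_forall_notMem_V h.chain.left_of_append
    (by grind) (by grind)
  have hP := hP.resolve_right fun H => H o (by simp) (o_mem_V n)
  have hchain := h.chain.right_of_append.tail
  rw [List.tail_cons] at hchain
  have hQ := forall_mem_V_or_forall_notMem_V hchain.right_of_append.tail
    (by grind) (by grind)
  have hM := forall_mem_V_or_forall_notMem_V hchain.left_of_append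
    (by grind) (by grind)
  rw [List.tail_cons] at hQ
  have hQ := hQ.resolve_right fun H => by
    have hlast := h.last
    simp only [List.cons_append, getLast?_cons_append_cons] at hlast
    rcases List.eq_nil_or_concat' Q with rfl | ⟨Q', z, rfl⟩
    · exact hxb (by simpa using hlast.symm)
    · rw [← List.cons_append, List.getLast?_concat] at hlast
      obtain rfl := Option.some.inj hlast
      exact H z (by simp) hx
  have hM := hM.resolve_left fun H => by
    have hc : b n + a n ∉ V n := fun hc => o_ne_b n (eq_a_of_add_a_mem (b_mem_V n) hc).symm
    have hmem := (h.mem_iff _).2 (mem_V_succ.2 (.inr (.inl ⟨_, b_mem_V n, rfl⟩)))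
    refine hc ?_
    simp only [List.mem_append, List.mem_cons] at hmem
    rcases hmem with (e | e) | e | e | e | e <;> try rw [e]
    · exact o_mem_V n
    · exact hP _ (by simp [e])
    · exact a_mem_V n
    · exact H _ e
    · exact b_mem_V n
    · exact hQ _ e
  exact ⟨(P, M ++ b n :: Q), ⟨h, fun y hy => hP y (by simp [hy]), M, Q, rfl, hM, hQ⟩, rfl⟩

lemma injOn_returning (n : ℕ) (x : ℝ × ℝ) :
    Set.InjOn (fun q : List (ℝ × ℝ) × List (ℝ × ℝ) => o :: (q.1 ++ a n :: q.2))
      (returning n x) := by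
  rintro ⟨P, R⟩ h ⟨P', R'⟩ h' e
  have hd := h.1.nodup
  have hd' := h'.1.nodup
  simp only [List.cons.injEq, true_and] at e hd hd'
  obtain ⟨h1, -, h2⟩ := (List.append_cons_inj_of_notMem (by grind) (by grind)).1 e
  rw [h1, h2]

lemma map_partRefl_mem_returning {n : ℕ} {x : ℝ × ℝ} {q : List (ℝ × ℝ) × List (ℝ × ℝ)}
    (hq : q ∈ returning n x) :
    ((q.1.map (partRefl n)).reverse, q.2.map (partRefl n)) ∈ returning n (partRefl n x) := by
  obtain ⟨P, R⟩ := q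
  obtain ⟨h, hP, M, Q, rfl, hM, hQ⟩ := hq
  dsimp only at h hP ⊢
  have hMmap : M.map (partRefl n) = M :=
    (List.map_congr_left fun y hy => partRefl_of_notMem (hM y hy)).trans (List.map_id' M)
  have hperm : (o :: ((P.map (partRefl n)).reverse ++ a n :: (M ++ b n :: Q).map (partRefl n))).Perm
      ((o :: (P ++ a n :: (M ++ b n :: Q))).map (partRefl n)) := by
    have e1 : o :: ((P.map (partRefl n)).reverse ++ a n :: (M ++ b n :: Q).map (partRefl n)) =
      (a n :: (P.map (partRefl n) ++ [o])).reverse ++ (M ++ b n :: Q).map (partRefl n) := by simp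
    have e2 : (o :: (P ++ a n :: (M ++ b n :: Q))).map (partRefl n) =
      (a n :: (P.map (partRefl n) ++ [o])) ++ (M ++ b n :: Q).map (partRefl n) := by simp
    rw [e1, e2]
    exact (List.reverse_perm _).append_right _
  refine ⟨⟨?_, ?_, fun y => ?_, rfl, ?_⟩, ?_, M, Q.map (partRefl n), ?_, hM, ?_⟩
  · have hc := h.chain
    rw [List.isChain_cons_split, ← List.cons_append (as := M), List.isChain_split (l₁ := a n :: M)] at hc
    rw [List.map_append, hMmap, List.map_cons, partRefl_b, List.isChain_cons_split,
      ← List.cons_append (as := M), List.isChain_split (l₁ := a n :: M)]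
    refine ⟨?_, hc.2.1, ?_⟩
    · have := isChain_map_partRefl hc.1 (by
        intro y hy
        simp only [List.mem_cons, List.mem_append, List.not_mem_nil, or_false] at hy
        rcases hy with rfl | hy | rfl
        exacts [o_mem_V n, hP y hy, a_mem_V n])
      have := List.isChain_reverse.2 (this.imp fun _ _ e => e.symm)
      simpa using this
    · simpa using isChain_map_partRefl hc.2.2 (List.forall_mem_cons.2 ⟨b_mem_V n, hQ⟩)
  · exact hperm.nodup_iff.2 (h.nodup.map (partRefl_injective n))
  · rw [hperm.mem_iff, ← partRefl_mem_V_succ_iff, ← h.mem_iff]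
    conv_lhs => rw [← partRefl_partRefl n y, List.mem_map_of_injective (partRefl_injective n)]
  · have := congrArg (Option.map (partRefl n)) h.last
    rw [getLast?_cons_append_cons, ← List.cons_append, List.getLast?_append_cons,
      ← List.getLast?_map, List.map_cons, partRefl_b] at this
    rwa [getLast?_cons_append_cons, List.map_append, List.map_cons, partRefl_b,
      ← List.cons_append, List.getLast?_append_cons]
  · intro y hy
    simp only [List.mem_reverse, List.mem_map] at hy
    obtain ⟨z, hz, rfl⟩ := hy
    exact partRefl_mem_V_iff.2 (hP z hz)
  · simp [hMmap]
  · intro y hy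
    obtain ⟨z, hz, rfl⟩ := List.mem_map.1 hy
    exact partRefl_mem_V_iff.2 (hQ z hz)

/-! ### Most Hamiltonian paths end far from `o` -/

lemma finite_returning (n : ℕ) (x : ℝ × ℝ) : (returning n x).Finite :=
  .of_injOn (fun _ hq => hq.1) (injOn_returning n x) (isHamList_finite (n + 1) o x)

lemma ncard_returning_le_f (n : ℕ) (x : ℝ × ℝ) : (returning n x).ncard ≤ f (n + 1) o x := by
  rw [f_eq_ncard]
  exact Set.ncard_le_ncard_of_injOn _ (fun _ hq => hq.1) (injOn_returning n x)
    (isHamList_finite _ _ _)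

lemma ncard_returning_le_partRefl (n : ℕ) (x : ℝ × ℝ) :
    (returning n x).ncard ≤ (returning n (partRefl n x)).ncard := by
  refine Set.ncard_le_ncard_of_injOn _ (fun _ hq => map_partRefl_mem_returning hq) ?_
    (finite_returning _ _)
  rintro ⟨P, R⟩ - ⟨P', R'⟩ - h
  have hinj := List.map_injective_iff.2 (partRefl_injective n)
  simp only [Prod.mk.injEq, List.reverse_inj] at h
  rw [hinj h.1, hinj h.2]

lemma f_succ_le {n : ℕ} {x : ℝ × ℝ} (hx : x ∈ V n) (hxa : x ≠ a n) (hxb : x ≠ b n) :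
    f (n + 1) o x ≤ f (n + 1) o (reflOA n x) + f (n + 1) o (reflOA n (reflAB x)) := by
  have hx' := reflAB_mem_V hx
  have hxb' : reflAB x ≠ b n := fun h => hxa (reflAB_injective (h.trans (reflAB_a n).symm))
  let glue (q : List (ℝ × ℝ) × List (ℝ × ℝ)) : List (ℝ × ℝ) := o :: (q.1 ++ a n :: q.2)
  have hsub : {l | IsHamList (n + 1) (V (n + 1)) o x l} ⊆ glue '' returning n x ∪
      List.map reflAB '' (glue '' returning n (reflAB x)) := by
    intro l hl
    have hl' := hl.map reflAB_injective fun _ _ => adj_reflAB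
    rw [image_reflAB, reflAB_o] at hl'
    obtain ⟨A, B, rfl⟩ := List.append_of_mem
      ((hl.mem_iff (a n)).2 (mem_V_succ.2 (.inl (a_mem_V n))))
    have hb := (hl.mem_iff (b n)).2 (mem_V_succ.2 (.inl (b_mem_V n)))
    rw [List.mem_append, List.mem_cons] at hb
    rcases hb with hb | hb | hb
    · obtain ⟨A, C, rfl⟩ := List.append_of_mem hb
      right
      refine ⟨_, hl'.mem_returning (A := A.map reflAB)
        (B := C.map reflAB ++ b n :: B.map reflAB) ?_ (by simp) hx' hxb', ?_⟩
      · simp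
      · rw [List.map_map]
        exact (List.map_congr_left fun y _ => reflAB_reflAB y).trans (List.map_id' _)
    · exact absurd hb.symm (a_ne_b n)
    · exact .inl (hl.mem_returning rfl hb hx hxb)
  have h1 := finite_returning n x
  have h2 := finite_returning n (reflAB x)
  calc f (n + 1) o x = {l | IsHamList (n + 1) (V (n + 1)) o x l}.ncard := f_eq_ncard _ _ _
    _ ≤ (glue '' returning n x ∪ List.map reflAB '' (glue '' returning n (reflAB x))).ncard :=
      Set.ncard_le_ncard hsub ((h1.image _).union ((h2.image _).image _))
    _ ≤ (returning n x).ncard + (returning n (reflAB x)).ncard :=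
      (Set.ncard_union_le _ _).trans (add_le_add (Set.ncard_image_le h1)
        ((Set.ncard_image_le (h2.image _)).trans (Set.ncard_image_le h2)))
    _ ≤ _ := by
      rw [← partRefl_of_mem hx, ← partRefl_of_mem hx']
      exact add_le_add
        ((ncard_returning_le_partRefl n _).trans (ncard_returning_le_f n _))
        ((ncard_returning_le_partRefl n _).trans (ncard_returning_le_f n _))

/-- the vertices of `SG n` other than `o` -/
def ends (n : ℕ) : Finset (ℝ × ℝ) := (V_finite n).toFinset.erase o

lemma mem_ends {n : ℕ} {x : ℝ × ℝ} : x ∈ ends n ↔ x ≠ o ∧ x ∈ V n := by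
  simp [ends]

lemma H0_eq_sum (n : ℕ) : H0 n = ∑ x ∈ ends n, f n o x := by
  refine finsum_mem_eq_sum_of_inter_support_eq _ (Set.ext fun x => ?_)
  simp only [Set.mem_inter_iff, Set.mem_ofPred_eq, Function.mem_support, Finset.mem_coe, mem_ends]
  have := @mem_V_of_f_ne_zero n x
  tauto

lemma xi_eq_sum (n : ℕ) (ℓ : ℝ) : xi n ℓ = ∑ x ∈ ends n, enorm x ^ ℓ * p n x := by
  have : {x : ℝ × ℝ | x ∈ V n ∧ x ≠ o} = ↑(ends n) := by
    ext x
    simp [mem_ends, and_comm]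
  rw [xi, this, finsum_mem_coe_finset]

lemma H0_pos (n : ℕ) : 0 < H0 n := by
  rw [H0_eq_sum]
  exact (f_o_a_pos n).trans_le (Finset.single_le_sum (f := fun x => f n o x)
    (fun _ _ => Nat.zero_le _) (mem_ends.2 ⟨(o_ne_a n).symm, a_mem_V n⟩))

lemma fst_le_enorm (x : ℝ × ℝ) : x.1 ≤ enorm x :=
  Real.le_sqrt_of_sq_le (by nlinarith [sq_nonneg x.2])

lemma enorm_reflAB (x : ℝ × ℝ) : enorm (reflAB x) = enorm x := by
  have h := sq3_sq
  simp only [enorm, reflAB]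
  congr 1
  linear_combination (x.1 ^ 2 + x.2 ^ 2) / 4 * h

lemma enorm_le {n : ℕ} {x : ℝ × ℝ} (hx : x ∈ V n) : enorm x ≤ 2 * 2 ^ n := by
  obtain ⟨h0, h1, h2⟩ := mem_triangle hx
  have hs := sq3_pos
  have h3 := fst_nonneg hx
  have hx1 : x.1 ≤ 2 ^ n := le_of_mul_le_mul_left (by linarith) hs
  have hx2 : x.2 ≤ sq3 * 2 ^ n := by nlinarith
  refine Real.sqrt_le_iff.2 ⟨by positivity, ?_⟩
  have e1 : x.1 ^ 2 ≤ (2 ^ n) ^ 2 := pow_le_pow_left₀ h3 hx1 2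
  have e2 : x.2 ^ 2 ≤ (sq3 * 2 ^ n) ^ 2 := pow_le_pow_left₀ h0 hx2 2
  have e3 : (sq3 * 2 ^ n) ^ 2 = 3 * (2 ^ n) ^ 2 := by
    linear_combination (2 ^ n) ^ 2 * sq3_sq
  linarith

lemma mem_V_of_fst_lt {n : ℕ} {x : ℝ × ℝ} (hx : x ∈ V (n + 1)) (h : x.1 < 2 ^ n / 2) :
    x ∈ V n ∧ x ≠ a n ∧ x ≠ b n := by
  have h2 : (0:ℝ) < 2 ^ n := by positivity
  refine ⟨?_, ?_, ?_⟩
  · rcases mem_V_succ.1 hx with hx | ⟨y, hy, rfl⟩ | ⟨y, hy, rfl⟩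
    · exact hx
    all_goals
      have := fst_nonneg hy
      simp only [a, b, Prod.fst_add] at h
      linarith
  · rintro rfl
    simp only [a] at h
    linarith
  · rintro rfl
    simp only [b] at h
    linarith

/-- At least one third of the Hamiltonian paths of `SG (n + 1)` starting at `o` end at distance
at least `2 ^ (n - 1)` from `o`. -/
lemma H0_succ_le (n : ℕ) :
    H0 (n + 1) ≤ 3 * ∑ x ∈ ends (n + 1) with (2:ℝ) ^ n / 2 ≤ enorm x, f (n + 1) o x := by
  set far := {x ∈ ends (n + 1) | (2:ℝ) ^ n / 2 ≤ enorm x} with hfar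
  set near := {x ∈ ends (n + 1) | ¬ (2:ℝ) ^ n / 2 ≤ enorm x} with hnear
  have hsplit : H0 (n + 1) = ∑ x ∈ far, f (n + 1) o x + ∑ x ∈ near, f (n + 1) o x := by
    rw [H0_eq_sum, Finset.sum_filter_add_sum_filter_not]
  have hmem {x : ℝ × ℝ} (hx : x ∈ near) : x ≠ o ∧ x ∈ V n ∧ x ≠ a n ∧ x ≠ b n ∧
      enorm x < 2 ^ n / 2 := by
    rw [hnear, Finset.mem_filter, mem_ends, not_le] at hx
    obtain ⟨h1, h2, h3⟩ := mem_V_of_fst_lt hx.1.2 ((fst_le_enorm x).trans_lt hx.2)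
    exact ⟨hx.1.1, h1, h2, h3, hx.2⟩
  have hrefl {x : ℝ × ℝ} (hx : x ∈ V n) (hxa : x ≠ a n) (h : enorm x < 2 ^ n / 2) :
      reflOA n x ∈ far := by
    rw [hfar, Finset.mem_filter, mem_ends]
    refine ⟨⟨fun e => hxa (reflOA_injective n (e.trans (reflOA_a n).symm)),
      mem_V_succ.2 (.inl (reflOA_mem_V hx))⟩, le_trans ?_ (fst_le_enorm _)⟩
    have := fst_le_enorm x
    simp only [reflOA]
    linarith
  have hbound {φ : ℝ × ℝ → ℝ × ℝ} (hφ : Function.Injective φ) (h : ∀ x ∈ near, φ x ∈ far) :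
      ∑ x ∈ near, f (n + 1) o (φ x) ≤ ∑ x ∈ far, f (n + 1) o x := by
    rw [← Finset.sum_image (f := fun x => f (n + 1) o x) hφ.injOn]
    exact Finset.sum_le_sum_of_subset (Finset.image_subset_iff.2 h)
  have h1 := hbound (reflOA_injective n) fun x hx =>
    hrefl (hmem hx).2.1 (hmem hx).2.2.1 (hmem hx).2.2.2.2
  have h2 := hbound ((reflOA_injective n).comp reflAB_injective) fun x hx => by
    obtain ⟨-, hV, -, hxb, hn⟩ := hmem hx
    exact hrefl (reflAB_mem_V hV) (fun e => hxb (reflAB_injective (e.trans (reflAB_b n).symm)))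
      (by rwa [enorm_reflAB])
  have h3 : ∑ x ∈ near, f (n + 1) o x ≤ _ := Finset.sum_le_sum fun x hx =>
    f_succ_le (hmem hx).2.1 (hmem hx).2.2.1 (hmem hx).2.2.2.1
  rw [Finset.sum_add_distrib] at h3
  simp only [Function.comp_apply] at h2
  linarith

lemma p_nonneg (n : ℕ) (x : ℝ × ℝ) : 0 ≤ p n x := by unfold p; positivity

lemma enorm_nonneg (x : ℝ × ℝ) : 0 ≤ enorm x := Real.sqrt_nonneg _

lemma sum_p (n : ℕ) : ∑ x ∈ ends n, p n x = 1 := by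
  have h : (0:ℝ) < H0 n := by exact_mod_cast H0_pos n
  simp only [p]
  rw [← Finset.sum_div, div_eq_one_iff_eq h.ne', H0_eq_sum, Nat.cast_sum]

lemma xi_le (n : ℕ) {ℓ : ℝ} (hℓ : 0 < ℓ) : xi n ℓ ≤ (2 * 2 ^ n) ^ ℓ := by
  rw [xi_eq_sum, ← mul_one ((2 * 2 ^ n : ℝ) ^ ℓ), ← sum_p n, Finset.mul_sum]
  exact Finset.sum_le_sum fun x hx => mul_le_mul_of_nonneg_right
    (Real.rpow_le_rpow (enorm_nonneg x) (enorm_le (mem_ends.1 hx).2) hℓ.le) (p_nonneg n x)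

lemma le_xi_succ (n : ℕ) {ℓ : ℝ} (hℓ : 0 < ℓ) : (2 ^ n / 2) ^ ℓ / 3 ≤ xi (n + 1) ℓ := by
  have hH : (0:ℝ) < H0 (n + 1) := by exact_mod_cast H0_pos (n + 1)
  have h : 1 / 3 ≤ ∑ x ∈ ends (n + 1) with (2:ℝ) ^ n / 2 ≤ enorm x, p (n + 1) x := by
    simp only [p]
    rw [← Finset.sum_div, div_le_div_iff₀ (by norm_num) hH]
    have : (H0 (n + 1) : ℝ) ≤ 3 * ∑ x ∈ ends (n + 1) with (2:ℝ) ^ n / 2 ≤ enorm x,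
      (f (n + 1) o x : ℝ) := by exact_mod_cast H0_succ_le n
    linarith
  calc (2 ^ n / 2 : ℝ) ^ ℓ / 3 = (2 ^ n / 2 : ℝ) ^ ℓ * (1 / 3) := by ring
    _ ≤ (2 ^ n / 2 : ℝ) ^ ℓ * ∑ x ∈ ends (n + 1) with (2:ℝ) ^ n / 2 ≤ enorm x, p (n + 1) x := by
      gcongr
    _ ≤ ∑ x ∈ ends (n + 1) with (2:ℝ) ^ n / 2 ≤ enorm x, enorm x ^ ℓ * p (n + 1) x := by
      rw [Finset.mul_sum]
      exact Finset.sum_le_sum fun x hx => mul_le_mul_of_nonneg_right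
        (Real.rpow_le_rpow (by positivity) (Finset.mem_filter.1 hx).2 hℓ.le) (p_nonneg _ x)
    _ ≤ xi (n + 1) ℓ := by
      rw [xi_eq_sum]
      exact Finset.sum_le_sum_of_subset_of_nonneg (Finset.filter_subset _ _) fun x _ _ =>
        mul_nonneg (Real.rpow_nonneg (enorm_nonneg x) ℓ) (p_nonneg _ x)

/-! ### The exponent -/

lemma tendsto_div_of_abs_sub_le {u : ℕ → ℝ} {s K : ℝ} (h : ∀ n : ℕ, |u (n + 1) - (n + 1) * s| ≤ K) :
    Tendsto (fun n : ℕ => u n / n) atTop (𝓝 s) := by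
  rw [← tendsto_add_atTop_iff_nat 1]
  have hK : Tendsto (fun n : ℕ => K / ((n + 1 : ℕ) : ℝ)) atTop (𝓝 0) :=
    (tendsto_const_div_atTop_nhds_zero_nat K).comp (tendsto_add_atTop_nat 1)
  rw [tendsto_iff_norm_sub_tendsto_zero]
  refine squeeze_zero (fun _ => norm_nonneg _) (fun n => ?_) hK
  have hn : (0:ℝ) < n + 1 := by positivity
  push_cast
  rw [Real.norm_eq_abs, div_sub' hn.ne', abs_div, abs_of_pos hn]
  exact div_le_div_of_nonneg_right (h n) hn.le

lemma tendsto_log_xi_div {ℓ : ℝ} (hℓ : 0 < ℓ) :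
    Tendsto (fun n : ℕ => Real.log (xi n ℓ) / n) atTop (𝓝 (ℓ * Real.log 2)) := by
  refine tendsto_div_of_abs_sub_le (K := 2 * ℓ * Real.log 2 + Real.log 3) fun n => ?_
  have h2 : 0 < Real.log 2 := Real.log_pos (by norm_num)
  have h3 : 0 < Real.log 3 := Real.log_pos (by norm_num)
  have hl2 : 0 < ℓ * Real.log 2 := by positivity
  have hlow : (0:ℝ) < (2 ^ n / 2) ^ ℓ / 3 := by positivity
  have e1 := Real.log_le_log hlow (le_xi_succ n hℓ)
  have e2 := Real.log_le_log (hlow.trans_le (le_xi_succ n hℓ)) (xi_le (n + 1) hℓ)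
  rw [Real.log_div (by positivity) (by norm_num), Real.log_rpow (by positivity),
    Real.log_div (by positivity) (by norm_num), Real.log_pow] at e1
  rw [Real.log_rpow (by positivity), Real.log_mul (by norm_num) (by positivity),
    Real.log_pow] at e2
  push_cast at e1 e2
  rw [abs_le]
  constructor <;> nlinarith

lemma tendsto_log_length_div :
    Tendsto (fun n : ℕ => Real.log ((3 ^ (n + 1) + 1) / 2) / n) atTop (𝓝 (Real.log 3)) := by
  refine tendsto_div_of_abs_sub_le (K := Real.log 3) fun n => ?_
  have h3 : 0 < Real.log 3 := Real.log_pos (by norm_num)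
  have hp : (0:ℝ) < 3 ^ (n + 1) := by positivity
  have e1 : Real.log (3 ^ (n + 1)) ≤ Real.log ((3 ^ (n + 1 + 1) + 1) / 2) :=
    Real.log_le_log hp (by rw [pow_succ _ (n + 1)]; linarith)
  have e2 : Real.log ((3 ^ (n + 1 + 1) + 1) / 2) ≤ Real.log (3 ^ (n + 1 + 1)) :=
    Real.log_le_log (by positivity) (by
      have : (1:ℝ) ≤ 3 ^ (n + 1 + 1) := one_le_pow₀ (by norm_num)
      linarith)
  rw [Real.log_pow] at e1 e2
  push_cast at e1 e2
  rw [abs_le]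
  constructor <;> nlinarith

/-- the exponent of the mean `ℓ` displacement is `ℓ·log 2 / log 3`. -/
theorem xi_exponent : ∀ ℓ : ℝ, 0 < ℓ →
    Filter.Tendsto
      (fun n : ℕ => Real.log (xi n ℓ) / Real.log ((3 ^ (n + 1) + 1) / 2))
      Filter.atTop (nhds (ℓ * Real.log 2 / Real.log 3)) := by
  intro ℓ hℓ
  have h := (tendsto_log_xi_div hℓ).div tendsto_log_length_div
    (Real.log_pos (by norm_num : (1:ℝ) < 3)).ne'
  refine h.congr' ?_
  filter_upwards [eventually_gt_atTop 0] with n hn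
  exact div_div_div_cancel_right₀ (by positivity) _ _

end SierpinskiGasket
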